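/- Scalar φ-de Bruijn identity for the Gaussian channel: if p(x,θ) is a probability density on ℝ, positive, smooth, satisfying the heat equation ∂p/∂θ = (1/2)∂²p/∂x², if φ is C² convex with φ(0)=0, if differentiation under the integral sign in θ is valid for ∫φ(p)dx, and if φ(p(x,θ)) and ∂ₓ[φ(p(x,θ))] tend to 0 as x → ±∞, then d/dθ H_φ(p) = (1/2) J^{(φ)}(p), where H_φ(p) = -∫φ(p)dx and J^{(φ)}(p) = ∫ (∂ₓ log p)² p² φ''(p) dx. -/

import Mathlib

open Real MeasureTheory


lemma exists_cutoff : ∃ (f f1 f2 : ℝ → ℝ) (C : ℝ), (∀ x, HasDerivAt f (f1 x) x) ∧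
    (∀ x, HasDerivAt f1 (f2 x) x) ∧ Continuous f2 ∧ (∀ x, |f1 x| ≤ C) ∧ (∀ x, |f2 x| ≤ C) ∧
    (∀ x, |f x| ≤ 1) ∧ f 0 = 1 ∧ HasCompactSupport f := by
  let b : ContDiffBump (0 : ℝ) := ⟨1, 2, by norm_num, by norm_num⟩
  have h3 : ContDiff ℝ 2 (b : ℝ → ℝ) := b.contDiff
  have h2 : ContDiff ℝ 1 (deriv (b : ℝ → ℝ)) := by
    have := (contDiff_succ_iff_deriv (n := 1) (f := (b : ℝ → ℝ))).1 (h3.of_le one_add_one_eq_two.le)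
    exact this.2.2
  have h1 : Continuous (deriv (deriv (b : ℝ → ℝ))) := h2.continuous_deriv le_rfl
  have hc1 : HasCompactSupport (deriv (b : ℝ → ℝ)) := b.hasCompactSupport.deriv
  have hc2 : HasCompactSupport (deriv (deriv (b : ℝ → ℝ))) := hc1.deriv
  obtain ⟨C1, hC1⟩ := hc1.exists_bound_of_continuous h2.continuous
  obtain ⟨C2, hC2⟩ := hc2.exists_bound_of_continuous h1
  refine ⟨b, deriv b, deriv (deriv b), max C1 C2, fun x => ?_, fun x => ?_, h1, fun x => ?_,
    fun x => ?_, fun x => ?_, ?_, b.hasCompactSupport⟩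
  · exact (h3.differentiable (by norm_num) x).hasDerivAt
  · exact (h2.differentiable (by norm_num) x).hasDerivAt
  · exact (hC1 x).trans (le_max_left _ _)
  · exact (hC2 x).trans (le_max_right _ _)
  · rw [abs_of_nonneg b.nonneg]; exact b.le_one
  · exact b.one_of_mem_closedBall (by simp [b])

/-- Differentiation of a compactly supported parametric integral. -/
lemma hasDerivAt_param (S : Set ℝ) (hS : IsOpen S) (χ : ℝ → ℝ) (hχ : Continuous χ)
    (hχc : HasCompactSupport χ) (F F' : ℝ → ℝ → ℝ)
    (hF : ∀ s ∈ S, Continuous (fun y => F y s))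
    (hF' : ContinuousOn (Function.uncurry F') (Set.univ ×ˢ S))
    (hd : ∀ y, ∀ s ∈ S, HasDerivAt (fun s => F y s) (F' y s) s) (s : ℝ) (hs : s ∈ S) :
    HasDerivAt (fun s => ∫ y, χ y * F y s) (∫ y, χ y * F' y s) s := by
  obtain ⟨ε, hε, hball⟩ := Metric.nhds_basis_closedBall.mem_iff.1 (hS.mem_nhds hs)
  have hcont : ∀ t ∈ S, Continuous (fun y => F' y t) := fun t ht =>
    hF'.comp_continuous (f := fun y : ℝ => (y, t)) (by fun_prop) (fun y => ⟨trivial, ht⟩)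
  have hK : IsCompact (tsupport χ ×ˢ Metric.closedBall s ε) :=
    IsCompact.prod hχc (isCompact_closedBall s ε)
  obtain ⟨M, hM⟩ := hK.exists_bound_of_continuousOn
    (hF'.mono (Set.prod_mono (Set.subset_univ _) hball))
  refine (hasDerivAt_integral_of_dominated_loc_of_deriv_le (F := fun s y => χ y * F y s)
    (F' := fun s y => χ y * F' y s)
    (bound := fun y => |χ y| * M) (Metric.closedBall_mem_nhds s hε) ?_ ?_ ?_ ?_ ?_ ?_).2
  · filter_upwards [hS.mem_nhds hs] with t ht
    exact (hχ.mul (hF t ht)).aestronglyMeasurable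
  · exact (hχ.mul (hF s hs)).integrable_of_hasCompactSupport hχc.mul_right
  · exact (hχ.mul (hcont s hs)).aestronglyMeasurable
  · refine Filter.Eventually.of_forall fun y t ht => ?_
    by_cases hy : y ∈ tsupport χ
    · have := hM (y, t) ⟨hy, ht⟩
      rw [norm_mul]
      exact mul_le_mul_of_nonneg_left this (norm_nonneg _)
    · simp [image_eq_zero_of_notMem_tsupport hy]
  · exact (hχ.abs.mul continuous_const).integrable_of_hasCompactSupport
      (hχc.norm.mul_right)
  · exact Filter.Eventually.of_forall fun y t ht => (hd y t (hball ht)).const_mul _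

/-- Duality between the forward and the backward heat equation. -/
lemma heat_duality (S : Set ℝ) (hS : IsOpen S) (a b : ℝ) (hab : a ≤ b) (hSab : Set.Icc a b ⊆ S)
    (p px pxx k kx kxx : ℝ → ℝ → ℝ) (M : ℝ)
    (hpx : ∀ y, ∀ s ∈ S, HasDerivAt (fun y => p y s) (px y s) y)
    (hpxx : ∀ y, ∀ s ∈ S, HasDerivAt (fun y => px y s) (pxx y s) y)
    (hpt : ∀ y, ∀ s ∈ S, HasDerivAt (fun s => p y s) (1 / 2 * pxx y s) s)
    (hkx : ∀ y, ∀ s ∈ S, HasDerivAt (fun y => k y s) (kx y s) y)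
    (hkxx : ∀ y, ∀ s ∈ S, HasDerivAt (fun y => kx y s) (kxx y s) y)
    (hkt : ∀ y, ∀ s ∈ S, HasDerivAt (fun s => k y s) (-(1 / 2 * kxx y s)) s)
    (hpc : ContinuousOn (Function.uncurry p) (Set.univ ×ˢ S))
    (hpxxc : ContinuousOn (Function.uncurry pxx) (Set.univ ×ˢ S))
    (hkc : ContinuousOn (Function.uncurry k) (Set.univ ×ˢ S))
    (hkxxc : ContinuousOn (Function.uncurry kxx) (Set.univ ×ˢ S))
    (hpos : ∀ y, ∀ s ∈ S, 0 < p y s) (hint : ∀ s ∈ S, ∫ y, p y s = 1)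
    (hk1 : ∀ y, ∀ s ∈ Set.Icc a b, |k y s| ≤ M) (hk2 : ∀ y, ∀ s ∈ Set.Icc a b, |kx y s| ≤ M) :
    ∫ y, k y a * p y a = ∫ y, k y b * p y b := by
  obtain ⟨f, f1, f2, C, hf1, hf2, hf2c, hb1, hb2, hb0, hf0, hfc⟩ := exists_cutoff
  have hC : 0 ≤ C := (abs_nonneg _).trans (hb1 0)
  have hM : 0 ≤ M := (abs_nonneg _).trans (hk1 0 a ⟨le_rfl, hab⟩)
  have hpi : ∀ s ∈ S, Integrable (fun y => p y s) := fun s hs =>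
    integrable_of_integral_eq_one (hint s hs)
  have hfcont : Continuous f := continuous_iff_continuousAt.2 fun x => (hf1 x).continuousAt
  have hf1cont : Continuous f1 := continuous_iff_continuousAt.2 fun x => (hf2 x).continuousAt
  have hsl : ∀ (g : ℝ → ℝ → ℝ), ContinuousOn (Function.uncurry g) (Set.univ ×ˢ S) →
      ∀ t ∈ S, Continuous (fun y => g y t) := fun g hg t ht =>
    hg.comp_continuous (f := fun y : ℝ => (y, t)) (by fun_prop) (fun y => ⟨trivial, ht⟩)
  have hpxcont : ∀ t ∈ S, Continuous (fun y => px y t) := fun t ht =>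
    continuous_iff_continuousAt.2 fun x => (hpxx x t ht).continuousAt
  have hkxcont : ∀ t ∈ S, Continuous (fun y => kx y t) := fun t ht =>
    continuous_iff_continuousAt.2 fun x => (hkxx x t ht).continuousAt
  -- estimate for a cutoff at scale `1/c`
  have key : ∀ c : ℝ, 0 < c → c ≤ 1 →
      |(∫ y, f (c * y) * (k y b * p y b)) - ∫ y, f (c * y) * (k y a * p y a)|
        ≤ (3 * C * M * c) * (b - a) := by
    intro c hc hc1
    have hχc : HasCompactSupport (fun y => f (c * y)) := by
      have := hfc.comp_homeomorph (Homeomorph.mulLeft₀ c hc.ne')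
      exact this
    have hχcont : Continuous (fun y => f (c * y)) := by fun_prop
    have hχ1 : ∀ y, HasDerivAt (fun y => f (c * y)) (c * f1 (c * y)) y := fun y => by
      have := (hf1 (c * y)).comp y ((hasDerivAt_id y).const_mul c)
      simpa [Function.comp_def, mul_comm] using this
    have hχ2 : ∀ y, HasDerivAt (fun y => c * f1 (c * y)) (c * (c * f2 (c * y))) y := fun y => by
      have := ((hf2 (c * y)).comp y ((hasDerivAt_id y).const_mul c)).const_mul c
      simpa [Function.comp_def, mul_comm] using this
    have hχ1c : HasCompactSupport (fun y => c * f1 (c * y)) := by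
      have := hχc.deriv
      rwa [funext fun y => (hχ1 y).deriv] at this
    have hχ2c : HasCompactSupport (fun y => c * (c * f2 (c * y))) := by
      have := hχ1c.deriv
      rwa [funext fun y => (hχ2 y).deriv] at this
    have hder : ∀ s ∈ S, HasDerivAt (fun s => ∫ y, f (c * y) * (k y s * p y s))
        (∫ y, f (c * y) * (-(1 / 2 * kxx y s) * p y s + k y s * (1 / 2 * pxx y s))) s := by
      intro s hs
      refine hasDerivAt_param S hS _ hχcont hχc (fun y s => k y s * p y s)
        (fun y s => -(1 / 2 * kxx y s) * p y s + k y s * (1 / 2 * pxx y s)) ?_ ?_ ?_ s hs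
      · exact fun t ht => (hsl k hkc t ht).mul (hsl p hpc t ht)
      · exact (((continuousOn_const.mul hkxxc).neg).mul hpc).add
          (hkc.mul (continuousOn_const.mul hpxxc))
      · exact fun y t ht => (hkt y t ht).mul (hpt y t ht)
    have hbd : ∀ s ∈ Set.Icc a b,
        ‖∫ y, f (c * y) * (-(1 / 2 * kxx y s) * p y s + k y s * (1 / 2 * pxx y s))‖
          ≤ 3 * C * M * c := by
      intro s hs
      have hsS := hSab hs
      have cp := hsl p hpc s hsS
      have ck := hsl k hkc s hsS
      have cpxx := hsl pxx hpxxc s hsS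
      have ckxx := hsl kxx hkxxc s hsS
      have cpx := hpxcont s hsS
      have ckx := hkxcont s hsS
      have i1 : Integrable (fun y => f (c * y) *
          (-(1 / 2 * kxx y s) * p y s + k y s * (1 / 2 * pxx y s))) :=
        (hχcont.mul (by fun_prop)).integrable_of_hasCompactSupport hχc.mul_right
      have i2a : Integrable (fun y => (c * (c * f2 (c * y))) * (1 / 2 * (p y s * k y s))) :=
        Continuous.integrable_of_hasCompactSupport (by fun_prop) hχ2c.mul_right
      have i2b : Integrable (fun y => (c * f1 (c * y)) * (p y s * kx y s)) :=
        Continuous.integrable_of_hasCompactSupport (by fun_prop) hχ1c.mul_right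
      have i2 : Integrable (fun y => (c * (c * f2 (c * y))) * (1 / 2 * (p y s * k y s)) +
          (c * f1 (c * y)) * (p y s * kx y s)) := i2a.add i2b
      have i3 : Integrable (fun y => f (c * y) * (1 / 2 * (px y s * k y s - p y s * kx y s))
          - (c * f1 (c * y)) * (1 / 2 * (p y s * k y s))) :=
        Integrable.sub (Continuous.integrable_of_hasCompactSupport (by fun_prop) hχc.mul_right)
          (Continuous.integrable_of_hasCompactSupport (by fun_prop) hχ1c.mul_right)
      have h0 := integral_eq_zero_of_hasDerivAt_of_integrable (f' := fun y =>
          f (c * y) * (-(1 / 2 * kxx y s) * p y s + k y s * (1 / 2 * pxx y s)) -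
          ((c * (c * f2 (c * y))) * (1 / 2 * (p y s * k y s)) +
            (c * f1 (c * y)) * (p y s * kx y s))) (f := fun y =>
          f (c * y) * (1 / 2 * (px y s * k y s - p y s * kx y s))
          - (c * f1 (c * y)) * (1 / 2 * (p y s * k y s))) ?_ (i1.sub i2) i3
      · rw [integral_sub i1 i2, sub_eq_zero] at h0
        rw [h0]
        refine (norm_integral_le_of_norm_le ((hpi s hsS).const_mul (3 * C * M * c)) ?_).trans ?_
        · refine Filter.Eventually.of_forall fun y => ?_
          have hp := (hpos y s hsS).le
          have e1 : |c * (c * f2 (c * y)) * (1 / 2 * (p y s * k y s))| ≤ C * M * c * p y s := by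
            have : |c * (c * f2 (c * y)) * (1 / 2 * (p y s * k y s))|
              = (c * 1 / 2) * c * (|f2 (c * y)| * |k y s|) * p y s := by
              simp only [abs_mul, abs_of_pos hc, abs_of_nonneg hp]; norm_num; ring
            rw [this]
            have h := mul_le_mul (hb2 (c * y)) (hk1 y s hs) (abs_nonneg _) hC
            have : (c * 1 / 2) * c * (|f2 (c * y)| * |k y s|) ≤ 1 * c * (C * M) := by
              gcongr
              linarith
            calc _ ≤ 1 * c * (C * M) * p y s := by gcongr
              _ = _ := by ring
          have e2 : |c * f1 (c * y) * (p y s * kx y s)| ≤ C * M * c * p y s := by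
            have : |c * f1 (c * y) * (p y s * kx y s)|
              = c * (|f1 (c * y)| * |kx y s|) * p y s := by
              simp only [abs_mul, abs_of_pos hc, abs_of_nonneg hp]; ring
            rw [this]
            have h := mul_le_mul (hb1 (c * y)) (hk2 y s hs) (abs_nonneg _) hC
            calc _ ≤ c * (C * M) * p y s := by gcongr
              _ = _ := by ring
          have e3 : 0 ≤ C * M * c * p y s := by positivity
          rw [Real.norm_eq_abs]
          refine (abs_add_le _ _).trans ?_
          linarith
        · rw [integral_const_mul, hint s hsS, mul_one]
      · intro y
        have d1 := (hχ1 y).mul ((((hpxx y s hsS).mul (hkx y s hsS)).sub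
          ((hpx y s hsS).mul (hkxx y s hsS))).const_mul (1 / 2))
        have d2 := (hχ2 y).mul (((hpx y s hsS).mul (hkx y s hsS)).const_mul (1 / 2))
        refine HasDerivAt.congr_deriv (d1.sub d2) ?_
        simp only [Pi.mul_apply, Pi.sub_apply]
        ring
    have := (convex_Icc a b).norm_image_sub_le_of_norm_hasDerivWithin_le
      (fun s hs => (hder s (hSab hs)).hasDerivWithinAt) hbd
      (Set.left_mem_Icc.2 hab) (Set.right_mem_Icc.2 hab)
    rwa [Real.norm_eq_abs, Real.norm_eq_abs, abs_of_nonneg (sub_nonneg.2 hab)] at this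
  -- the limit
  have hlim : ∀ s ∈ Set.Icc a b, Filter.Tendsto
      (fun n : ℕ => ∫ y, f (1 / ((n : ℝ) + 1) * y) * (k y s * p y s)) Filter.atTop
      (nhds (∫ y, k y s * p y s)) := by
    intro s hs
    have hsS := hSab hs
    have cp := hsl p hpc s hsS
    have ck := hsl k hkc s hsS
    refine tendsto_integral_of_dominated_convergence (fun y => M * p y s) ?_
      ((hpi s hsS).const_mul M) ?_ ?_
    · intro n
      exact Continuous.aestronglyMeasurable (by fun_prop)
    · intro n
      refine Filter.Eventually.of_forall fun y => ?_
      rw [norm_mul, norm_mul]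
      simp only [Real.norm_eq_abs, abs_of_pos (hpos y s hsS)]
      have := mul_le_mul_of_nonneg_right (hk1 y s hs) (hpos y s hsS).le
      have h0 : 0 ≤ |k y s| * p y s := mul_nonneg (abs_nonneg _) (hpos y s hsS).le
      nlinarith [hb0 (1 / ((n : ℝ) + 1) * y)]
    · refine Filter.Eventually.of_forall fun y => ?_
      have h1 : Filter.Tendsto (fun n : ℕ => 1 / ((n : ℝ) + 1) * y) Filter.atTop (nhds 0) := by
        simpa using (tendsto_one_div_add_atTop_nhds_zero_nat (𝕜 := ℝ)).mul_const y
      have h2 := ((hfcont.tendsto 0).comp h1).mul_const (k y s * p y s)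
      simpa [hf0, Function.comp_def] using h2
  have hl := ((hlim b (Set.right_mem_Icc.2 hab)).sub (hlim a (Set.left_mem_Icc.2 hab))).abs
  have hr : Filter.Tendsto (fun n : ℕ => (3 * C * M * (1 / ((n : ℝ) + 1))) * (b - a))
      Filter.atTop (nhds 0) := by
    simpa using ((tendsto_one_div_add_atTop_nhds_zero_nat (𝕜 := ℝ)).const_mul
      (3 * C * M)).mul_const (b - a)
  have := le_of_tendsto_of_tendsto' hl hr (fun n => key _ (by positivity) (by
    rw [div_le_one (by positivity)]; linarith [(Nat.cast_nonneg n : (0 : ℝ) ≤ n)]))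
  have := abs_eq_zero.1 (le_antisymm this (abs_nonneg _))
  linarith

/-- The (unnormalised) heat kernel. -/
noncomputable def hk (τ x : ℝ) : ℝ := (√τ)⁻¹ * Real.exp (-(x ^ 2) / (2 * τ))

lemma hk_nonneg (τ x : ℝ) : 0 ≤ hk τ x := by unfold hk; positivity

lemma hk_le (τ x : ℝ) (hτ : 0 < τ) : hk τ x ≤ (√τ)⁻¹ := by
  unfold hk
  refine mul_le_of_le_one_right (by positivity) ?_
  rw [Real.exp_le_one_iff]
  exact div_nonpos_of_nonpos_of_nonneg (by nlinarith [sq_nonneg x]) (by positivity)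

lemma hk_hasDerivAt_x (τ x : ℝ) (hτ : 0 < τ) : HasDerivAt (hk τ) (-(x / τ) * hk τ x) x := by
  have h : HasDerivAt (fun x : ℝ => -(x ^ 2) / (2 * τ)) (-(x / τ)) x := by
    have := ((hasDerivAt_pow 2 x).neg).div_const (2 * τ)
    refine this.congr_deriv ?_
    norm_num
    field_simp
  refine (h.exp.const_mul ((√τ)⁻¹)).congr_deriv ?_
  unfold hk
  ring

lemma hk_hasDerivAt_xx (τ x : ℝ) (hτ : 0 < τ) :
    HasDerivAt (fun x => -(x / τ) * hk τ x) ((x ^ 2 / τ ^ 2 - 1 / τ) * hk τ x) x := by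
  have := (((hasDerivAt_id x).div_const τ).neg).mul (hk_hasDerivAt_x τ x hτ)
  refine this.congr_deriv ?_
  simp
  ring

lemma hk_hasDerivAt_t (τ x : ℝ) (hτ : 0 < τ) :
    HasDerivAt (fun τ => hk τ x) (1 / 2 * ((x ^ 2 / τ ^ 2 - 1 / τ) * hk τ x)) τ := by
  have h1 : HasDerivAt (fun τ : ℝ => -(x ^ 2) / (2 * τ)) (x ^ 2 / (2 * τ ^ 2)) τ := by
    have := (hasDerivAt_const τ (-(x ^ 2))).div ((hasDerivAt_id τ).const_mul 2) (by simpa using hτ.ne')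
    refine this.congr_deriv ?_
    simp
    field_simp
  have hs : 0 < √τ := Real.sqrt_pos.2 hτ
  have h2 := ((hasDerivAt_id τ).sqrt hτ.ne').inv hs.ne'
  refine (h2.mul h1.exp).congr_deriv ?_
  have hsq : τ = √τ ^ 2 := (Real.sq_sqrt hτ.le).symm
  unfold hk
  simp only [id, Pi.inv_apply]
  set r := √τ
  clear_value r
  subst hsq
  field_simp
  ring

lemma hk_continuousOn : ContinuousOn (Function.uncurry hk) (Set.Ioi 0 ×ˢ Set.univ) := by
  unfold hk
  simp only [Function.uncurry_def]
  refine ContinuousOn.mul (ContinuousOn.inv₀ (by fun_prop) ?_) (Real.continuous_exp.comp_continuousOn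
    (ContinuousOn.div (by fun_prop) (by fun_prop) ?_))
  · rintro ⟨t, x⟩ ⟨ht, -⟩
    exact (Real.sqrt_pos.2 ht).ne'
  · rintro ⟨t, x⟩ ⟨ht, -⟩
    have : (0 : ℝ) < t := ht
    positivity

lemma hk_x_le (τ x : ℝ) (hτ : 0 < τ) : |-(x / τ) * hk τ x| ≤ 1 / τ := by
  have hs : 0 < √τ := Real.sqrt_pos.2 hτ
  have h1 : |x| / √τ ≤ Real.exp (x ^ 2 / (2 * τ)) := by
    refine le_trans ?_ (Real.add_one_le_exp _)
    have hsq : √τ ^ 2 = τ := Real.sq_sqrt hτ.le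
    have e : x ^ 2 / (2 * τ) = (|x| / √τ) ^ 2 / 2 := by
      rw [div_pow, hsq, sq_abs]; ring
    rw [e]
    nlinarith [sq_nonneg (|x| / √τ - 1)]
  have e : |-(x / τ) * hk τ x| = 1 / τ * ((|x| / √τ) * Real.exp (-(x ^ 2 / (2 * τ)))) := by
    rw [abs_mul, abs_neg, abs_div, abs_of_pos hτ, abs_of_nonneg (hk_nonneg _ _)]
    unfold hk
    rw [neg_div]; field_simp
  rw [e]
  refine mul_le_of_le_one_right (by positivity) ?_
  rw [Real.exp_neg, ← div_eq_mul_inv, div_le_one (Real.exp_pos _)]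
  exact h1

lemma hk_xx_le (τ x : ℝ) (hτ : 0 < τ) :
    |(x ^ 2 / τ ^ 2 - 1 / τ) * hk τ x| ≤ 3 / τ * (√τ)⁻¹ := by
  have hs : 0 < √τ := Real.sqrt_pos.2 hτ
  have h1 : x ^ 2 / (2 * τ) * Real.exp (-(x ^ 2 / (2 * τ))) ≤ 1 := by
    rw [Real.exp_neg, ← div_eq_mul_inv, div_le_one (Real.exp_pos _)]
    linarith [Real.add_one_le_exp (x ^ 2 / (2 * τ))]
  have h2 : x ^ 2 / τ ^ 2 * hk τ x ≤ 2 / τ * (√τ)⁻¹ := by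
    have : x ^ 2 / τ ^ 2 * hk τ x
        = 2 / τ * (√τ)⁻¹ * (x ^ 2 / (2 * τ) * Real.exp (-(x ^ 2 / (2 * τ)))) := by
      unfold hk
      rw [neg_div]; field_simp
    rw [this]
    exact mul_le_of_le_one_right (by positivity) h1
  have h3 : 1 / τ * hk τ x ≤ 1 / τ * (√τ)⁻¹ :=
    mul_le_mul_of_nonneg_left (hk_le τ x hτ) (by positivity)
  have h4 : 0 ≤ x ^ 2 / τ ^ 2 * hk τ x := mul_nonneg (by positivity) (hk_nonneg _ _)
  have h5 : 0 ≤ 1 / τ * hk τ x := mul_nonneg (by positivity) (hk_nonneg _ _)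
  have h6 : 3 / τ * (√τ)⁻¹ = 2 / τ * (√τ)⁻¹ + 1 / τ * (√τ)⁻¹ := by ring
  have h7 : 0 ≤ 2 / τ * (√τ)⁻¹ := by positivity
  have h8 : 0 ≤ 1 / τ * (√τ)⁻¹ := by positivity
  rw [abs_le, sub_mul]
  constructor <;> linarith

lemma hk_xx_integrable (τ : ℝ) (hτ : 0 < τ) :
    Integrable (fun x => (x ^ 2 / τ ^ 2 - 1 / τ) * hk τ x) := by
  have hb : 0 < 1 / (2 * τ) := by positivity
  have h1 := (integrable_rpow_mul_exp_neg_mul_sq hb (s := 2) (by norm_num)).const_mul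
    ((√τ)⁻¹ / τ ^ 2)
  have h2 := (integrable_exp_neg_mul_sq hb).const_mul ((√τ)⁻¹ / τ)
  refine (h1.sub h2).congr (Filter.Eventually.of_forall fun x => ?_)
  have e : -(x ^ 2) / (2 * τ) = -(1 / (2 * τ)) * x ^ 2 := by ring
  simp only [hk, Pi.sub_apply, e]
  rw [Real.rpow_two]
  ring

/-- The heat kernel is an approximate identity. -/
lemma hk_peak (g : ℝ → ℝ) (hg : Integrable g) (hgc : Continuous g) (z : ℝ) :
    Filter.Tendsto (fun c : ℝ => ∫ y, hk ((c ^ 2)⁻¹) (z - y) * g y) Filter.atTop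
      (nhds (√(2 * π) * g z)) := by
  have hpi : 0 < √(2 * π) := Real.sqrt_pos.2 (by positivity)
  have h := tendsto_integral_comp_smul_smul_of_integrable' (μ := volume) (F := ℝ)
    (φ := fun x => (√(2 * π))⁻¹ * Real.exp (-(1 / 2) * x ^ 2)) (fun x => by positivity) ?_ ?_
    hg (x₀ := z) hgc.continuousAt
  · refine (h.const_mul (√(2 * π))).congr' ?_
    filter_upwards [Filter.eventually_gt_atTop 0] with c hc
    rw [← integral_const_mul]
    refine integral_congr_ae (Filter.Eventually.of_forall fun y => ?_)
    have e : -((z - y) ^ 2) / (2 * (c ^ 2)⁻¹) = -(1 / 2) * (c * (z - y)) ^ 2 := by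
      field_simp
    simp only [Module.finrank_self, pow_one, smul_eq_mul, hk, Real.sqrt_inv, Real.sqrt_sq hc.le,
      inv_inv, e]
    field_simp
  · rw [integral_const_mul, integral_gaussian]
    have : π / (1 / 2) = 2 * π := by ring
    rw [this, inv_mul_cancel₀ hpi.ne']
  · have h1 : Filter.Tendsto (fun x : ℝ => x ^ (1:ℝ) * Real.exp (-(1 / 2) * x ^ 2))
        Filter.atTop (nhds 0) :=
      (rpow_mul_exp_neg_mul_sq_isLittleO_exp_neg (b := 1 / 2) (by norm_num) 1).trans_tendsto (by
        refine Real.tendsto_exp_atBot.comp ?_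
        exact Filter.tendsto_id.const_mul_atTop_of_neg (by norm_num))
    have h2 := (h1.comp (tendsto_norm_cobounded_atTop (E := ℝ))).mul_const ((√(2 * π))⁻¹)
    rw [zero_mul] at h2
    refine h2.congr fun x => ?_
    simp
    ring

lemma partial_x (P : ℝ × ℝ → ℝ) (hP : ContDiff ℝ (⊤ : ℕ∞) P) :
    ∃ Q : ℝ × ℝ → ℝ, ContDiff ℝ (⊤ : ℕ∞) Q ∧
      ∀ y s, HasDerivAt (fun y => P (y, s)) (Q (y, s)) y := by
  refine ⟨fun q => fderiv ℝ P q (1, 0), ?_, fun y s => ?_⟩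
  · exact (hP.fderiv_right (m := (⊤ : ℕ∞)) (by simp)).clm_apply contDiff_const
  · have h1 := (hP.differentiable (by simp) (y, s)).hasFDerivAt
    have h2 : HasDerivAt (fun y : ℝ => (y, s)) ((1 : ℝ), (0 : ℝ)) y :=
      (hasDerivAt_id y).prodMk (hasDerivAt_const y s)
    exact h1.comp_hasDerivAt y h2

/-- Gaussian representation of positive, mass one solutions of the heat equation. -/
lemma heat_repr (Θ : Set ℝ) (hΘ : IsOpen Θ) (a θ : ℝ) (hab : a < θ) (hI : Set.Icc a θ ⊆ Θ)
    (p px pxx : ℝ → ℝ → ℝ)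
    (hpx : ∀ y, ∀ s ∈ Θ, HasDerivAt (fun y => p y s) (px y s) y)
    (hpxx : ∀ y, ∀ s ∈ Θ, HasDerivAt (fun y => px y s) (pxx y s) y)
    (hpt : ∀ y, ∀ s ∈ Θ, HasDerivAt (fun s => p y s) (1 / 2 * pxx y s) s)
    (hpc : Continuous (Function.uncurry p)) (hpxxc : Continuous (Function.uncurry pxx))
    (hpos : ∀ y, ∀ s ∈ Θ, 0 < p y s) (hint : ∀ s ∈ Θ, ∫ y, p y s = 1) (z : ℝ) :
    √(2 * π) * p z θ = ∫ y, hk (θ - a) (z - y) * p y a := by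
  have haΘ : a ∈ Θ := hI (Set.left_mem_Icc.2 hab.le)
  have hθΘ : θ ∈ Θ := hI (Set.right_mem_Icc.2 hab.le)
  have hpi : ∀ s ∈ Θ, Integrable (fun y => p y s) := fun s hs =>
    integrable_of_integral_eq_one (hint s hs)
  have hd : ∀ δ : ℝ, 0 < δ →
      ∫ y, hk (θ + δ - a) (z - y) * p y a = ∫ y, hk δ (z - y) * p y θ := by
    intro δ hδ
    have hsub : ∀ y : ℝ, HasDerivAt (fun y => z - y) (-1) y := fun y => by
      simpa using (hasDerivAt_id y).const_sub z
    have hsubt : ∀ s : ℝ, HasDerivAt (fun s => θ + δ - s) (-1) s := fun s => by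
      simpa using (hasDerivAt_id s).const_sub (θ + δ)
    have hτ : ∀ s ∈ Θ ∩ Set.Iio (θ + δ), 0 < θ + δ - s := fun s hs => sub_pos.2 hs.2
    have hτ' : ∀ s ∈ Set.Icc a θ, δ ≤ θ + δ - s := fun s hs => by linarith [hs.2]
    have hkc : ContinuousOn (Function.uncurry fun y s => hk (θ + δ - s) (z - y))
        (Set.univ ×ˢ (Θ ∩ Set.Iio (θ + δ))) := by
      refine hk_continuousOn.comp (f := fun q : ℝ × ℝ => (θ + δ - q.2, z - q.1)) (by fun_prop) ?_
      rintro ⟨y, s⟩ ⟨-, hs⟩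
      exact ⟨hτ s hs, trivial⟩
    have := heat_duality (Θ ∩ Set.Iio (θ + δ)) (hΘ.inter isOpen_Iio) a θ hab.le
      (fun s hs => ⟨hI hs, by have := hs.2; simp only [Set.mem_Iio]; linarith⟩)
      p px pxx (fun y s => hk (θ + δ - s) (z - y))
      (fun y s => -(-((z - y) / (θ + δ - s)) * hk (θ + δ - s) (z - y)))
      (fun y s => ((z - y) ^ 2 / (θ + δ - s) ^ 2 - 1 / (θ + δ - s)) * hk (θ + δ - s) (z - y))
      ((√δ)⁻¹ + 1 / δ)
      (fun y s hs => hpx y s hs.1) (fun y s hs => hpxx y s hs.1) (fun y s hs => hpt y s hs.1)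
      ?_ ?_ ?_ hpc.continuousOn hpxxc.continuousOn hkc ?_ (fun y s hs => hpos y s hs.1)
      (fun s hs => hint s hs.1) ?_ ?_
    · simpa using this
    · intro y s hs
      refine ((hk_hasDerivAt_x (θ + δ - s) (z - y) (hτ s hs)).comp y (hsub y)).congr_deriv ?_
      ring
    · intro y s hs
      refine (((hk_hasDerivAt_xx (θ + δ - s) (z - y) (hτ s hs)).comp y
        (hsub y)).neg).congr_deriv ?_
      ring
    · intro y s hs
      refine ((hk_hasDerivAt_t (θ + δ - s) (z - y) (hτ s hs)).comp s (hsubt s)).congr_deriv ?_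
      ring
    · refine ContinuousOn.mul (ContinuousOn.sub (ContinuousOn.div (by fun_prop) (by fun_prop) ?_)
        (ContinuousOn.div (by fun_prop) (by fun_prop) ?_)) hkc
      · rintro ⟨y, s⟩ ⟨-, hs⟩
        exact pow_ne_zero _ (hτ s hs).ne'
      · rintro ⟨y, s⟩ ⟨-, hs⟩
        exact (hτ s hs).ne'
    · intro y s hs
      have h := hτ' s hs
      rw [abs_of_nonneg (hk_nonneg _ _)]
      have h1 := hk_le (θ + δ - s) (z - y) (hδ.trans_le h)
      have h2 : (√(θ + δ - s))⁻¹ ≤ (√δ)⁻¹ :=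
        inv_anti₀ (Real.sqrt_pos.2 hδ) (Real.sqrt_le_sqrt h)
      have h3 : 0 < 1 / δ := by positivity
      linarith
    · intro y s hs
      have h := hτ' s hs
      rw [abs_neg]
      have h1 := hk_x_le (θ + δ - s) (z - y) (hδ.trans_le h)
      have h2 : 1 / (θ + δ - s) ≤ 1 / δ := one_div_le_one_div_of_le hδ h
      have h3 : 0 < (√δ)⁻¹ := inv_pos.2 (Real.sqrt_pos.2 hδ)
      linarith
  have hpsl : ∀ s, Continuous (fun y => p y s) := fun s =>
    hpc.comp (f := fun y : ℝ => (y, s)) (by fun_prop)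
  have hR := hk_peak (fun y => p y θ) (hpi θ hθΘ) (hpsl θ) z
  have hinv : Filter.Tendsto (fun c : ℝ => (c ^ 2)⁻¹) Filter.atTop (nhds 0) :=
    tendsto_inv_atTop_zero.comp (Filter.tendsto_pow_atTop (by norm_num))
  have hL : Filter.Tendsto (fun c : ℝ => ∫ y, hk (θ + (c ^ 2)⁻¹ - a) (z - y) * p y a)
      Filter.atTop (nhds (∫ y, hk (θ - a) (z - y) * p y a)) := by
    have hT : 0 < θ - a := sub_pos.2 hab
    have hge : ∀ c : ℝ, θ - a ≤ θ + (c ^ 2)⁻¹ - a := fun c => by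
      have : 0 ≤ (c ^ 2)⁻¹ := by positivity
      linarith
    refine tendsto_integral_filter_of_dominated_convergence (fun y => (√(θ - a))⁻¹ * p y a) ?_ ?_
      ((hpi a haΘ).const_mul _) ?_
    · refine Filter.Eventually.of_forall fun c => ?_
      have : Continuous fun y => hk (θ + (c ^ 2)⁻¹ - a) (z - y) := by unfold hk; fun_prop
      exact (this.mul (hpsl a)).aestronglyMeasurable
    · refine Filter.Eventually.of_forall fun c => Filter.Eventually.of_forall fun y => ?_
      rw [norm_mul, Real.norm_eq_abs, Real.norm_eq_abs, abs_of_nonneg (hk_nonneg _ _),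
        abs_of_pos (hpos y a haΘ)]
      refine mul_le_mul_of_nonneg_right ?_ (hpos y a haΘ).le
      exact (hk_le _ _ (hT.trans_le (hge c))).trans
        (inv_anti₀ (Real.sqrt_pos.2 hT) (Real.sqrt_le_sqrt (hge c)))
    · refine Filter.Eventually.of_forall fun y => ?_
      refine Filter.Tendsto.mul_const _ ?_
      have h1 := (hk_hasDerivAt_t (θ - a) (z - y) hT).continuousAt.tendsto
      refine h1.comp ?_
      have := (hinv.const_add θ).sub_const a
      simpa using this
  refine tendsto_nhds_unique hR (hL.congr' ?_)
  filter_upwards [Filter.eventually_gt_atTop 0] with c hc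
  exact hd _ (by positivity)

/-- Consequence: boundedness and integrability of the second derivative. -/
lemma heat_regular (a θ : ℝ) (hab : a < θ) (q u u1 u2 : ℝ → ℝ) (hq : Integrable q)
    (hqc : Continuous q)
    (hu1 : ∀ z, HasDerivAt u (u1 z) z) (hu2 : ∀ z, HasDerivAt u1 (u2 z) z)
    (hrep : ∀ z, √(2 * π) * u z = ∫ y, hk (θ - a) (z - y) * q y) :
    (∃ M, ∀ z, |u z| ≤ M) ∧ Integrable u2 := by
  have hpi : 0 < √(2 * π) := Real.sqrt_pos.2 (by positivity)
  set T := θ - a with hTdef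
  have hT : 0 < T := sub_pos.2 hab
  have hc0 : Continuous (hk T) := by unfold hk; fun_prop
  have hsub : ∀ y z : ℝ, HasDerivAt (fun z => z - y) 1 z := fun y z => by
    simpa using (hasDerivAt_id z).sub_const y
  have hkb : ∀ x, |hk T x| ≤ (√T)⁻¹ := fun x => by
    rw [abs_of_nonneg (hk_nonneg _ _)]; exact hk_le T x hT
  have gen : ∀ (k k1 : ℝ → ℝ) (B B1 : ℝ), Continuous k → Continuous k1 →
      (∀ x, |k x| ≤ B) → (∀ x, |k1 x| ≤ B1) → (∀ x, HasDerivAt k (k1 x) x) →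
      ∀ z, HasDerivAt (fun z => ∫ y, k (z - y) * q y) (∫ y, k1 (z - y) * q y) z := by
    intro k k1 B B1 hk hk1 hB hB1 hder z
    refine (hasDerivAt_integral_of_dominated_loc_of_deriv_le (s := Set.univ)
      (F := fun z y => k (z - y) * q y) (F' := fun z y => k1 (z - y) * q y)
      (bound := fun y => B1 * |q y|) Filter.univ_mem ?_ ?_ ?_ ?_ ?_ ?_).2
    · exact Filter.Eventually.of_forall fun z =>
        Continuous.aestronglyMeasurable (by fun_prop)
    · refine (hq.abs.const_mul B).mono' (Continuous.aestronglyMeasurable (by fun_prop)) ?_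
      refine Filter.Eventually.of_forall fun y => ?_
      rw [norm_mul]
      exact mul_le_mul_of_nonneg_right (hB _) (norm_nonneg _)
    · exact Continuous.aestronglyMeasurable (by fun_prop)
    · refine Filter.Eventually.of_forall fun y z _ => ?_
      rw [norm_mul]
      exact mul_le_mul_of_nonneg_right (hB1 _) (norm_nonneg _)
    · exact hq.abs.const_mul B1
    · refine Filter.Eventually.of_forall fun y z _ => ?_
      have := ((hder (z - y)).comp z (hsub y z)).mul_const (q y)
      simpa [Function.comp_def] using this
  have r1 : ∀ z, √(2 * π) * u1 z = ∫ y, (-((z - y) / T) * hk T (z - y)) * q y := by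
    intro z
    have h1 := gen (hk T) (fun x => -(x / T) * hk T x) _ _ hc0 (by fun_prop) hkb
      (fun x => hk_x_le T x hT) (fun x => hk_hasDerivAt_x T x hT) z
    have h2 := (hu1 z).const_mul (√(2 * π))
    rw [funext hrep] at h2
    exact h2.unique h1
  have r2 : ∀ z, √(2 * π) * u2 z
      = ∫ y, (((z - y) ^ 2 / T ^ 2 - 1 / T) * hk T (z - y)) * q y := by
    intro z
    have h1 := gen (fun x => -(x / T) * hk T x) (fun x => (x ^ 2 / T ^ 2 - 1 / T) * hk T x) _ _
      (by fun_prop) (by fun_prop) (fun x => hk_x_le T x hT)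
      (fun x => hk_xx_le T x hT) (fun x => hk_hasDerivAt_xx T x hT) z
    have h2 := (hu2 z).const_mul (√(2 * π))
    rw [funext r1] at h2
    exact h2.unique h1
  constructor
  · refine ⟨(√(2 * π))⁻¹ * ∫ y, (√T)⁻¹ * |q y|, fun z => ?_⟩
    have h1 : |√(2 * π) * u z| ≤ ∫ y, (√T)⁻¹ * |q y| := by
      rw [hrep z, ← Real.norm_eq_abs]
      refine norm_integral_le_of_norm_le (hq.abs.const_mul ((√T)⁻¹)) ?_
      refine Filter.Eventually.of_forall fun y => ?_
      rw [norm_mul]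
      exact mul_le_mul_of_nonneg_right (hkb _) (norm_nonneg _)
    rw [abs_mul, abs_of_pos hpi] at h1
    rw [← div_eq_inv_mul, le_div_iff₀ hpi]
    linarith
  · have h := (MeasureTheory.Integrable.integrable_convolution (μ := volume) (ContinuousLinearMap.mul ℝ ℝ) hq
      (hk_xx_integrable T hT)).const_mul ((√(2 * π))⁻¹)
    refine h.congr (Filter.Eventually.of_forall fun z => ?_)
    simp only [convolution, ContinuousLinearMap.mul_apply']
    have := r2 z
    have e : (∫ y, q y * (((z - y) ^ 2 / T ^ 2 - 1 / T) * hk T (z - y))) = √(2 * π) * u2 z := by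
      rw [this]
      exact integral_congr_ae (Filter.Eventually.of_forall fun y => mul_comm _ _)
    rw [e]
    field_simp

/-- Scalar φ-de Bruijn identity for the Gaussian channel: if the positive smooth
density `p(x,θ)` satisfies the heat equation `∂p/∂θ = (1/2)∂²p/∂x²`, then under
regularity and boundary-vanishing conditions,
`d/dθ H_φ(p) = (1/2) J^{(φ)}(p)`. -/
theorem scalar_phi_de_bruijn_gaussian
    (φ : ℝ → ℝ) (hφC2 : ContDiff ℝ 2 φ) (hconv : ConvexOn ℝ (Set.Ici 0) φ)
    (hφ0 : φ 0 = 0)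
    (Θ : Set ℝ) (hΘ : IsOpen Θ) (θ : ℝ) (hθ : θ ∈ Θ)
    (p : ℝ → ℝ → ℝ)
    (hpos : ∀ x t, t ∈ Θ → 0 < p x t)
    (hsmooth : ContDiff ℝ (⊤ : ℕ∞) (Function.uncurry p))
    (hdens : ∀ t ∈ Θ, ∫ x, p x t = 1)
    (hheat : ∀ x, ∀ t ∈ Θ,
      deriv (fun s => p x s) t = (1 / 2) * deriv (deriv (fun y => p y t)) x)
    (hdiff : ∀ t ∈ Θ, HasDerivAt (fun s => ∫ x, φ (p x s))
      (∫ x, deriv (fun s => φ (p x s)) t) t)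
    (hb1 : ∀ t ∈ Θ, Filter.Tendsto (fun x => φ (p x t))
      (Filter.atTop ⊔ Filter.atBot) (nhds 0))
    (hb2 : ∀ t ∈ Θ, Filter.Tendsto (fun x => deriv (fun y => φ (p y t)) x)
      (Filter.atTop ⊔ Filter.atBot) (nhds 0))
    (hJ : Integrable (fun x =>
      (deriv (fun y => Real.log (p y θ)) x) ^ 2 * (p x θ) ^ 2 * deriv (deriv φ) (p x θ))) :
    deriv (fun t => -∫ x, φ (p x t)) θ
      = (1 / 2) * ∫ x,
          (deriv (fun y => Real.log (p y θ)) x) ^ 2 * (p x θ) ^ 2 * deriv (deriv φ) (p x θ) := by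
  obtain ⟨Q1, hQ1, hd1⟩ := partial_x _ hsmooth
  obtain ⟨Q2, hQ2, hd2⟩ := partial_x _ hQ1
  have hd1' : ∀ y s, HasDerivAt (fun y => p y s) (Q1 (y, s)) y := fun y s => hd1 y s
  have e1 : ∀ s, deriv (fun y => p y s) = fun y => Q1 (y, s) := fun s =>
    funext fun y => (hd1' y s).deriv
  have hpt : ∀ y, ∀ s ∈ Θ, HasDerivAt (fun s => p y s) (1 / 2 * Q2 (y, s)) s := by
    intro y s hs
    have h := hheat y s hs
    rw [e1, (hd2 y s).deriv] at h
    rw [← h]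
    have : DifferentiableAt ℝ (fun s => p y s) s := by
      have h2 : Differentiable ℝ (fun s : ℝ => Function.uncurry p (y, s)) :=
        (hsmooth.differentiable (by simp)).comp (by fun_prop)
      exact h2 s
    exact this.hasDerivAt
  obtain ⟨ε, hε, hball⟩ := Metric.nhds_basis_closedBall.mem_iff.1 (hΘ.mem_nhds hθ)
  rw [Real.closedBall_eq_Icc] at hball
  have hI : Set.Icc (θ - ε) θ ⊆ Θ := fun s hs => hball ⟨hs.1, by linarith [hs.2]⟩
  have haΘ : θ - ε ∈ Θ := hI ⟨le_rfl, by linarith⟩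
  have hrep := heat_repr Θ hΘ (θ - ε) θ (by linarith) hI p (fun y s => Q1 (y, s))
    (fun y s => Q2 (y, s)) (fun y s _ => hd1' y s) (fun y s _ => hd2 y s) hpt
    hsmooth.continuous hQ2.continuous (fun y s hs => hpos y s hs) hdens
  have hpsl : ∀ s, Continuous (fun y => p y s) := fun s =>
    hsmooth.continuous.comp (f := fun y : ℝ => (y, s)) (by fun_prop)
  obtain ⟨⟨M, hM⟩, hint2⟩ := heat_regular (θ - ε) θ (by linarith) (fun y => p y (θ - ε))
    (fun y => p y θ) (fun y => Q1 (y, θ)) (fun y => Q2 (y, θ))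
    (integrable_of_integral_eq_one (hdens _ haΘ)) (hpsl _) (fun z => hd1' z θ)
    (fun z => hd2 z θ) hrep
  have hφ1 : ContDiff ℝ 1 (deriv φ) :=
    ((contDiff_succ_iff_deriv (n := 1) (f := φ)).1 (hφC2.of_le one_add_one_eq_two.le)).2.2
  have dφ : ∀ x, HasDerivAt φ (deriv φ x) x := fun x =>
    (hφC2.differentiable (by norm_num) x).hasDerivAt
  have dφ1 : ∀ x, HasDerivAt (deriv φ) (deriv (deriv φ) x) x := fun x =>
    (hφ1.differentiable (by norm_num) x).hasDerivAt
  -- the Fisher-type integrand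
  have ej : (fun x => (deriv (fun y => Real.log (p y θ)) x) ^ 2 * (p x θ) ^ 2 *
      deriv (deriv φ) (p x θ)) = fun x => deriv (deriv φ) (p x θ) * Q1 (x, θ) * Q1 (x, θ) := by
    funext x
    have hp := hpos x θ hθ
    rw [((hd1' x θ).log hp.ne').deriv]
    field_simp
  rw [ej] at hJ ⊢
  -- integrability of the time derivative
  obtain ⟨B, hB⟩ := (isCompact_Icc (a := -M) (b := M)).exists_bound_of_continuousOn
    hφ1.continuous.continuousOn
  have hA : Integrable (fun x => deriv φ (p x θ) * Q2 (x, θ)) := by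
    refine hint2.bdd_mul (c := B) (hφ1.continuous.comp (hpsl θ)).aestronglyMeasurable ?_
    exact Filter.Eventually.of_forall fun x => hB _ (abs_le.1 (hM x))
  have hg1 : ∀ s y, HasDerivAt (fun y => φ (p y s)) (deriv φ (p y s) * Q1 (y, s)) y :=
    fun s y => (dφ (p y s)).comp y (hd1' y s)
  have hg2 : ∀ x, HasDerivAt (fun y => deriv φ (p y θ))
      (deriv (deriv φ) (p x θ) * Q1 (x, θ)) x :=
    fun x => HasDerivAt.comp (h₂ := deriv φ) x (dφ1 (p x θ)) (hd1' x θ)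
  have hb := hb2 θ hθ
  rw [show (fun x => deriv (fun y => φ (p y θ)) x) = fun y => deriv φ (p y θ) * Q1 (y, θ) from
    funext fun y => (hg1 θ y).deriv, Filter.tendsto_sup] at hb
  have h0 := integral_of_hasDerivAt_of_tendsto
    (f := fun y => deriv φ (p y θ) * Q1 (y, θ))
    (f' := fun x => deriv (deriv φ) (p x θ) * Q1 (x, θ) * Q1 (x, θ)
      + deriv φ (p x θ) * Q2 (x, θ))
    (fun x => (hg2 x).mul (hd2 x θ)) (hJ.add hA) hb.2 hb.1
  rw [integral_add hJ hA, sub_zero] at h0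
  have et : (fun x => deriv (fun s => φ (p x s)) θ)
      = fun x => 1 / 2 * (deriv φ (p x θ) * Q2 (x, θ)) := by
    funext x
    have h : HasDerivAt (fun s => φ (p x s)) (deriv φ (p x θ) * (1 / 2 * Q2 (x, θ))) θ :=
      (dφ (p x θ)).comp θ (hpt x θ hθ)
    rw [h.deriv]
    ring
  have hfin := (hdiff θ hθ).neg
  rw [et, integral_const_mul] at hfin
  have hfin' : HasDerivAt (fun t => -∫ x, φ (p x t)) _ θ := hfin
  rw [hfin'.deriv]
  linarith
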